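/- Let Ψ = {A_1, …, A_m} be a finite set of n×n SR-matrices. Then there exists x ∈ D_Ψ that is Pareto optimal for e_{A_1}, …, e_{A_m} with respect to int(ℝ^n_+): for every y ∈ int(ℝ^n_+), if e_{A_i}(y) ≤ e_{A_i}(x) for all i = 1,…,m, then e_{A_i}(y) = e_{A_i}(x) for all i. In particular, such an x is simultaneously Pareto optimal and min-max optimal (since x ∈ D_Ψ implies max_i e_{A_i}(x) = μ̂(Ψ)). -/

import Mathlib

open Filter Relation

namespace MaxAlg

/-- Max-algebraic action of a matrix on a vector: `(A ⊗ x) i = max_j A i j * x j`. -/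
noncomputable def maxVec {n : ℕ} (A : Fin n → Fin n → ℝ) (x : Fin n → ℝ) : Fin n → ℝ :=
  fun i => ⨆ j, A i j * x j

/-- Max-algebraic matrix product: `(A ⊗ B) i k = max_j A i j * B j k`. -/
noncomputable def maxMul {n : ℕ} (A B : Fin n → Fin n → ℝ) : Fin n → Fin n → ℝ :=
  fun i k => ⨆ j, A i j * B j k

/-- The weight of the cycle determined by a list `[i₁, …, i_k]`,
namely `A i₁ i₂ * ⋯ * A i_{k-1} i_k * A i_k i₁`. -/
noncomputable def cycleProd {n : ℕ} (A : Fin n → Fin n → ℝ) (l : List (Fin n)) : ℝ :=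
  ((l.zip (l.rotate 1)).map fun p => A p.1 p.2).prod

/-- The maximal cycle geometric mean of `A`: the supremum over all cycles of distinct
nodes of the k-th root of the cycle weight. -/
noncomputable def mu {n : ℕ} (A : Fin n → Fin n → ℝ) : ℝ :=
  sSup {c | ∃ l : List (Fin n), l ≠ [] ∧ l.Nodup ∧ c = cycleProd A l ^ ((l.length : ℝ)⁻¹)}

/-- `C_{A,r}`: the positive vectors with `A ⊗ x ≤ r x`. -/
def Cset {n : ℕ} (A : Fin n → Fin n → ℝ) (r : ℝ) : Set (Fin n → ℝ) :=
  {x | (∀ i, 0 < x i) ∧ ∀ i, maxVec A x i ≤ r * x i}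

/-- A critical cycle: a cycle of distinct nodes attaining `mu A`. -/
def IsCriticalCycle {n : ℕ} (A : Fin n → Fin n → ℝ) (l : List (Fin n)) : Prop :=
  l ≠ [] ∧ l.Nodup ∧ cycleProd A l ^ ((l.length : ℝ)⁻¹) = mu A

/-- `(i,j) ∈ E^C(A)`: the edge `(i,j)` lies on some critical cycle. -/
def criticalEdge {n : ℕ} (A : Fin n → Fin n → ℝ) (i j : Fin n) : Prop :=
  ∃ l : List (Fin n), IsCriticalCycle A l ∧ (i, j) ∈ l.zip (l.rotate 1)

/-- `i ∈ N^C(A)`: the node `i` lies on some critical cycle. -/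
def criticalNode {n : ℕ} (A : Fin n → Fin n → ℝ) (i : Fin n) : Prop :=
  ∃ l : List (Fin n), IsCriticalCycle A l ∧ i ∈ l

/-- Irreducibility: the digraph of `A` (edge `(i,j)` iff `A i j > 0`) is strongly connected. -/
def Irred {n : ℕ} (A : Fin n → Fin n → ℝ) : Prop :=
  ∀ i j, Relation.ReflTransGen (fun a b => 0 < A a b) i j

/-- Max-algebraic product of a word of matrices from the family `A`. -/
noncomputable def wordProd {n m : ℕ} (A : Fin m → Fin n → Fin n → ℝ) :
    List (Fin m) → (Fin n → Fin n → ℝ)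
  | [] => fun i j => if i = j then 1 else 0
  | [j] => A j
  | j :: k :: w => maxMul (A j) (wordProd A (k :: w))

/-- The max version of the generalised spectral radius
`μ̂(Ψ) = limsup_{p→∞} (max_{ψ ∈ Ψ^p_⊗} μ(ψ))^{1/p}`. -/
noncomputable def genSpecRad {n m : ℕ} (A : Fin m → Fin n → Fin n → ℝ) : ℝ :=
  Filter.limsup
    (fun p : ℕ =>
      (sSup {c | ∃ w : List (Fin m), w.length = p ∧ c = mu (wordProd A w)}) ^ ((p : ℝ)⁻¹))
    Filter.atTop

/-- `S = A₁ ⊕ ⋯ ⊕ A_m`: the entrywise maximum of the family. -/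
noncomputable def Smat {n m : ℕ} (A : Fin m → Fin n → Fin n → ℝ) : Fin n → Fin n → ℝ :=
  fun i j => ⨆ k, A k i j

/-- The relative error function `e_A(x) = max_{i,j} A i j * x j / x i`. -/
noncomputable def errF {n : ℕ} (A : Fin n → Fin n → ℝ) (x : Fin n → ℝ) : ℝ :=
  ⨆ i, ⨆ j, A i j * x j / x i

/-- A symmetrically reciprocal (SR) matrix: positive, with unit diagonal and
`A i j * A j i = 1` for `i ≠ j`. -/
def IsSR {n : ℕ} (A : Fin n → Fin n → ℝ) : Prop :=
  (∀ i j, 0 < A i j) ∧ (∀ i, A i i = 1) ∧ ∀ i j, i ≠ j → A i j * A j i = 1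

/-- Max-algebraic matrix powers. -/
noncomputable def maxPow {n : ℕ} (B : Fin n → Fin n → ℝ) : ℕ → (Fin n → Fin n → ℝ)
  | 0 => fun i j => if i = j then 1 else 0
  | p + 1 => maxMul B (maxPow B p)

/-- The Kleene star `B* = I ⊕ B ⊕ B⊗² ⊕ ⋯ ⊕ B⊗^{n-1}`. -/
noncomputable def kleeneStar {n : ℕ} (B : Fin n → Fin n → ℝ) : Fin n → Fin n → ℝ :=
  fun i j => ⨆ p : Fin n, maxPow B p i j

lemma le_ciSup_of_finite {ι : Type*} [Finite ι] (f : ι → ℝ) (i : ι) : f i ≤ ⨆ j, f j :=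
  le_ciSup (Set.finite_range f).bddAbove i

lemma continuousOn_ciSup_of_finite {X ι : Type*} [TopologicalSpace X] [Finite ι] [Nonempty ι]
    {f : ι → X → ℝ} {s : Set X} (hf : ∀ i, ContinuousOn (f i) s) :
    ContinuousOn (fun x => ⨆ i, f i x) s := by
  have := Fintype.ofFinite ι
  simp_rw [← Finset.sup'_univ_eq_ciSup]
  exact ContinuousOn.finset_sup'_apply _ fun i _ => hf i

lemma errF_le_iff {n : ℕ} [NeZero n] {A : Fin n → Fin n → ℝ} {x : Fin n → ℝ} {r : ℝ}
    (hx : ∀ i, 0 < x i) : errF A x ≤ r ↔ ∀ i j, A i j * x j ≤ r * x i := by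
  constructor
  · intro h i j
    rw [← div_le_iff₀ (hx i)]
    exact ((le_ciSup_of_finite (fun j => A i j * x j / x i) j).trans
      (le_ciSup_of_finite (fun i => ⨆ j, A i j * x j / x i) i)).trans h
  · intro h
    exact ciSup_le fun i => ciSup_le fun j => (div_le_iff₀ (hx i)).2 (h i j)

lemma mem_Cset_iff {n : ℕ} [NeZero n] {A : Fin n → Fin n → ℝ} {x : Fin n → ℝ} {r : ℝ} :
    x ∈ Cset A r ↔ (∀ i, 0 < x i) ∧ errF A x ≤ r := by
  refine and_congr_right fun hx => Iff.trans (forall_congr' fun i => ?_) (errF_le_iff hx).symm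
  exact ⟨fun h j => (le_ciSup_of_finite (fun j => A i j * x j) j).trans h, fun h => ciSup_le h⟩

lemma errF_smul {n : ℕ} (A : Fin n → Fin n → ℝ) (x : Fin n → ℝ) {c : ℝ} (hc : c ≠ 0) :
    errF A (fun i => c * x i) = errF A x := by
  unfold errF
  congr! 4 with i j
  rw [mul_left_comm, mul_div_mul_left _ _ hc]

lemma continuousOn_errF {n : ℕ} [NeZero n] (A : Fin n → Fin n → ℝ) :
    ContinuousOn (errF A) {x | ∀ i, 0 < x i} :=
  continuousOn_ciSup_of_finite fun i => continuousOn_ciSup_of_finite fun j =>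
    ContinuousOn.div (by fun_prop) (by fun_prop) fun x hx => (hx i).ne'

lemma cycleProd_nonneg {n : ℕ} {A : Fin n → Fin n → ℝ} (hA : ∀ i j, 0 ≤ A i j)
    (l : List (Fin n)) : 0 ≤ cycleProd A l :=
  List.prod_nonneg fun _ h => by
    obtain ⟨p, -, rfl⟩ := List.mem_map.1 h
    exact hA _ _

lemma prod_zip_le {n : ℕ} {A : Fin n → Fin n → ℝ} {x : Fin n → ℝ} {c : ℝ}
    (hx : ∀ i, 0 < x i) (hA : ∀ i j, 0 ≤ A i j) (hc : 0 ≤ c)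
    (h : ∀ i j, A i j * x j ≤ c * x i) :
    ∀ l l' : List (Fin n), l.length = l'.length →
      ((l.zip l').map fun p => A p.1 p.2).prod * (l'.map x).prod ≤ c ^ l.length * (l.map x).prod
  | [], [], _ => by simp
  | a :: l, b :: l', hl => by
    have ih := prod_zip_le hx hA hc h l l' (by simpa using hl)
    have h1 : 0 ≤ ((l.zip l').map fun p => A p.1 p.2).prod * (l'.map x).prod :=
      mul_nonneg (List.prod_nonneg (by simp; grind)) (List.prod_nonneg (by simp; grind))
    have := mul_le_mul (h a b) ih h1 (mul_nonneg hc (hx a).le)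
    simp only [List.zip_cons_cons, List.map_cons, List.prod_cons, List.length_cons, pow_succ]
    linarith

lemma cycleProd_le {n : ℕ} {A : Fin n → Fin n → ℝ} {x : Fin n → ℝ} {c : ℝ}
    (hx : ∀ i, 0 < x i) (hA : ∀ i j, 0 ≤ A i j) (hc : 0 ≤ c)
    (h : ∀ i j, A i j * x j ≤ c * x i) (l : List (Fin n)) : cycleProd A l ≤ c ^ l.length := by
  have h1 := prod_zip_le hx hA hc h l (l.rotate 1) (by simp)
  rw [((List.rotate_perm l 1).map x).prod_eq] at h1
  refine le_of_mul_le_mul_right h1 (List.prod_pos fun a ha => ?_)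
  obtain ⟨i, -, rfl⟩ := List.mem_map.1 ha
  exact hx i

lemma cycleMean_le {n : ℕ} {A : Fin n → Fin n → ℝ} {x : Fin n → ℝ} {c : ℝ}
    (hx : ∀ i, 0 < x i) (hA : ∀ i j, 0 ≤ A i j) (hc : 0 ≤ c)
    (h : ∀ i j, A i j * x j ≤ c * x i) {l : List (Fin n)} (hl : l ≠ []) :
    cycleProd A l ^ ((l.length : ℝ)⁻¹) ≤ c :=
  (Real.rpow_le_rpow (cycleProd_nonneg hA l) (cycleProd_le hx hA hc h l) (by positivity)).trans_eq
    (Real.pow_rpow_inv_natCast hc (by simpa using hl))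

lemma mu_nonneg {n : ℕ} {A : Fin n → Fin n → ℝ} (hA : ∀ i j, 0 ≤ A i j) : 0 ≤ mu A :=
  Real.sSup_nonneg fun _ ⟨l, _, _, hc⟩ => hc ▸ Real.rpow_nonneg (cycleProd_nonneg hA l) _

lemma mu_le {n : ℕ} {A : Fin n → Fin n → ℝ} {x : Fin n → ℝ} {c : ℝ}
    (hx : ∀ i, 0 < x i) (hA : ∀ i j, 0 ≤ A i j) (hc : 0 ≤ c)
    (h : ∀ i j, A i j * x j ≤ c * x i) : mu A ≤ c :=
  Real.sSup_le (fun _ ⟨_, hl, _, ha⟩ => ha ▸ cycleMean_le hx hA hc h hl) hc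

lemma diag_le_mu {n : ℕ} {A : Fin n → Fin n → ℝ} (i : Fin n) : A i i ≤ mu A := by
  refine le_csSup (Set.Finite.bddAbove ?_) ⟨[i], by simp, by simp, by simp [cycleProd]⟩
  have hfin : {l : List (Fin n) | l.Nodup}.Finite :=
    (List.finite_length_le (Fin n) n).subset fun l hl => by
      simpa using List.Nodup.length_le_card hl
  refine (hfin.image fun l => cycleProd A l ^ ((l.length : ℝ)⁻¹)).subset ?_
  rintro c ⟨l, -, hl, rfl⟩
  exact ⟨l, hl, rfl⟩

lemma exists_entry_bound {n m : ℕ} (A : Fin m → Fin n → Fin n → ℝ) :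
    ∃ R, 0 ≤ R ∧ ∀ k i j, A k i j ≤ R := by
  obtain ⟨R, hR⟩ := (Set.finite_range fun q : Fin m × Fin n × Fin n => A q.1 q.2.1 q.2.2).bddAbove
  exact ⟨max R 0, le_max_right _ _, fun k i j =>
    (hR ⟨(k, i, j), rfl⟩).trans (le_max_left _ _)⟩

lemma mu_wordProd_le_sSup {n m : ℕ} {A : Fin m → Fin n → Fin n → ℝ}
    (w : List (Fin m)) :
    mu (wordProd A w) ≤ sSup {c | ∃ v : List (Fin m), v.length = w.length ∧
      c = mu (wordProd A v)} := by
  refine le_csSup (Set.Finite.bddAbove ?_) ⟨w, rfl, rfl⟩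
  refine ((List.finite_length_eq (Fin m) w.length).image fun v => mu (wordProd A v)).subset ?_
  rintro c ⟨v, hv, rfl⟩
  exact ⟨v, hv, rfl⟩

section WordProd

variable {n m : ℕ} [NeZero n] {A : Fin m → Fin n → Fin n → ℝ}

lemma wordProd_cons (hA : ∀ k i j, 0 ≤ A k i j) (k : Fin m) (w : List (Fin m)) :
    wordProd A (k :: w) = maxMul (A k) (wordProd A w) := by
  cases w with
  | cons => rfl
  | nil =>
    ext i j
    refine le_antisymm ?_ (ciSup_le fun a => ?_)
    · simpa [wordProd, maxMul] using le_ciSup_of_finite (fun a => A k i a * wordProd A [] a j) j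
    · by_cases h : a = j <;> simp [wordProd, h, hA]

lemma wordProd_nonneg (hA : ∀ k i j, 0 ≤ A k i j) (w : List (Fin m)) (i j : Fin n) :
    0 ≤ wordProd A w i j := by
  induction w generalizing i j with
  | nil => simp only [wordProd]; positivity
  | cons k w ih =>
    rw [wordProd_cons hA]
    exact Real.iSup_nonneg fun a => mul_nonneg (hA k i a) (ih a j)

lemma mul_wordProd_le (hA : ∀ k i j, 0 ≤ A k i j) (k : Fin m) (w : List (Fin m)) (i a j : Fin n) :
    A k i a * wordProd A w a j ≤ wordProd A (k :: w) i j := by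
  rw [wordProd_cons hA]
  exact le_ciSup_of_finite (fun a => A k i a * wordProd A w a j) a

lemma wordProd_mul_le (hA : ∀ k i j, 0 ≤ A k i j) {x : Fin n → ℝ} (hx : ∀ i, 0 < x i) {r : ℝ}
    (hr : 0 ≤ r) (h : ∀ k i j, A k i j * x j ≤ r * x i) (w : List (Fin m)) (i j : Fin n) :
    wordProd A w i j * x j ≤ r ^ w.length * x i := by
  induction w generalizing i j with
  | nil =>
    by_cases hij : i = j
    · simp [wordProd, hij]
    · simpa [wordProd, hij] using (hx i).le
  | cons k w ih =>
    rw [wordProd_cons hA, maxMul, Real.iSup_mul_of_nonneg (hx j).le]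
    refine ciSup_le fun a => ?_
    calc A k i a * wordProd A w a j * x j = A k i a * (wordProd A w a j * x j) := by ring
      _ ≤ A k i a * (r ^ w.length * x a) := mul_le_mul_of_nonneg_left (ih a j) (hA k i a)
      _ = r ^ w.length * (A k i a * x a) := by ring
      _ ≤ r ^ w.length * (r * x i) := mul_le_mul_of_nonneg_left (h k i a) (by positivity)
      _ = r ^ (k :: w).length * x i := by simp only [List.length_cons]; ring

lemma mu_wordProd_le (hA : ∀ k i j, 0 ≤ A k i j) {x : Fin n → ℝ} (hx : ∀ i, 0 < x i) {r : ℝ}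
    (hr : 0 ≤ r) (h : ∀ k i j, A k i j * x j ≤ r * x i) (w : List (Fin m)) :
    mu (wordProd A w) ≤ r ^ w.length :=
  mu_le hx (wordProd_nonneg hA w) (by positivity) (wordProd_mul_le hA hx hr h w)

lemma sSup_mu_wordProd_nonneg (hA : ∀ k i j, 0 ≤ A k i j) (p : ℕ) :
    0 ≤ sSup {c | ∃ w : List (Fin m), w.length = p ∧ c = mu (wordProd A w)} :=
  Real.sSup_nonneg fun _ ⟨w, _, hc⟩ => hc ▸ mu_nonneg (wordProd_nonneg hA w)

lemma eventually_root_sSup_mu_wordProd_le (hA : ∀ k i j, 0 ≤ A k i j) {x : Fin n → ℝ}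
    (hx : ∀ i, 0 < x i) {r : ℝ} (hr : 0 ≤ r) (h : ∀ k i j, A k i j * x j ≤ r * x i) :
    ∀ᶠ p : ℕ in atTop,
      (sSup {c | ∃ w : List (Fin m), w.length = p ∧ c = mu (wordProd A w)}) ^ ((p : ℝ)⁻¹) ≤ r := by
  filter_upwards [eventually_ne_atTop 0] with p hp
  refine (Real.rpow_le_rpow (sSup_mu_wordProd_nonneg hA p) ?_ (by positivity)).trans_eq
    (Real.pow_rpow_inv_natCast hr hp)
  refine Real.sSup_le ?_ (by positivity)
  rintro _ ⟨w, rfl, rfl⟩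
  exact mu_wordProd_le hA hx hr h w

lemma genSpecRad_le (hA : ∀ k i j, 0 ≤ A k i j) {x : Fin n → ℝ} (hx : ∀ i, 0 < x i) {r : ℝ}
    (hr : 0 ≤ r) (h : ∀ k i j, A k i j * x j ≤ r * x i) : genSpecRad A ≤ r :=
  Filter.limsup_le_of_le
    (isCoboundedUnder_le_of_le atTop (x := 0) fun p =>
      Real.rpow_nonneg (sSup_mu_wordProd_nonneg hA p) _)
    (eventually_root_sSup_mu_wordProd_le hA hx hr h)

lemma isBoundedUnder_root_sSup_mu_wordProd (hA : ∀ k i j, 0 ≤ A k i j) :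
    IsBoundedUnder (· ≤ ·) atTop fun p : ℕ =>
      (sSup {c | ∃ w : List (Fin m), w.length = p ∧ c = mu (wordProd A w)}) ^ ((p : ℝ)⁻¹) := by
  obtain ⟨R, hR0, hR⟩ := exists_entry_bound A
  exact ⟨R, Filter.eventually_map.2 (eventually_root_sSup_mu_wordProd_le hA (x := fun _ => 1)
    (fun _ => one_pos) hR0 (by simpa using hR))⟩

lemma genSpecRad_nonneg (hA : ∀ k i j, 0 ≤ A k i j) : 0 ≤ genSpecRad A :=
  Filter.le_limsup_of_frequently_le
    (Frequently.of_forall fun p => Real.rpow_nonneg (sSup_mu_wordProd_nonneg hA p) _)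
    (isBoundedUnder_root_sSup_mu_wordProd hA)

lemma eventually_mu_wordProd_le (hA : ∀ k i j, 0 ≤ A k i j) {r : ℝ} (hr : genSpecRad A < r) :
    ∃ N : ℕ, ∀ w : List (Fin m), N ≤ w.length → mu (wordProd A w) ≤ r ^ w.length := by
  obtain ⟨N, hN⟩ := eventually_atTop.1 ((Filter.eventually_lt_of_limsup_lt hr
    (isBoundedUnder_root_sSup_mu_wordProd hA)).and (eventually_ne_atTop 0))
  refine ⟨N, fun w hw => (mu_wordProd_le_sSup w).trans ?_⟩
  obtain ⟨h1, h2⟩ := hN _ hw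
  have h0 := sSup_mu_wordProd_nonneg hA w.length
  rw [← Real.rpow_natCast, ← Real.rpow_inv_le_iff_of_pos h0
    ((genSpecRad_nonneg hA).trans hr.le) (by positivity)]
  exact h1.le

lemma exists_wordProd_le (hm : 0 < m) (hA : ∀ k i j, 0 < A k i j) {r : ℝ}
    (hr : genSpecRad A < r) :
    ∃ C, ∀ (w : List (Fin m)) (i j : Fin n), wordProd A w i j ≤ C * r ^ w.length := by
  have hA' : ∀ k i j, 0 ≤ A k i j := fun k i j => (hA k i j).le
  have hr0 : 0 < r := (genSpecRad_nonneg hA').trans_lt hr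
  obtain ⟨R, hR0, hR⟩ := exists_entry_bound A
  obtain ⟨D, hD0, hD⟩ := exists_entry_bound fun (k : Fin m) i j => (A k i j)⁻¹
  obtain ⟨N, hN⟩ := eventually_mu_wordProd_le hA' hr
  have hS : 0 ≤ ∑ p ∈ Finset.range N, (R / r) ^ p := by positivity
  refine ⟨D * r + ∑ p ∈ Finset.range N, (R / r) ^ p, fun w i j => ?_⟩
  rw [add_mul]
  rcases lt_or_ge w.length N with hw | hw
  · have h1 : wordProd A w i j ≤ R ^ w.length := by
      simpa using wordProd_mul_le hA' (x := fun _ => 1) (fun _ => one_pos) hR0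
        (by simpa using hR) w i j
    have h2 : (R / r) ^ w.length ≤ ∑ p ∈ Finset.range N, (R / r) ^ p :=
      Finset.single_le_sum (f := fun p => (R / r) ^ p) (fun p _ => by positivity)
        (Finset.mem_range.2 hw)
    rw [div_pow, div_le_iff₀ (by positivity)] at h2
    have : 0 ≤ D * r * r ^ w.length := by positivity
    linarith
  · let k : Fin m := ⟨0, hm⟩
    have h1 : A k j i * wordProd A w i j ≤ r ^ (w.length + 1) :=
      ((mul_wordProd_le hA' k w j i j).trans (diag_le_mu j)).trans
        (hN (k :: w) (by simp only [List.length_cons]; omega))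
    have h2 : wordProd A w i j ≤ D * r * r ^ w.length :=
      calc wordProd A w i j = (A k j i)⁻¹ * (A k j i * wordProd A w i j) := by
            rw [inv_mul_cancel_left₀ (hA k j i).ne']
        _ ≤ D * r ^ (w.length + 1) := mul_le_mul (hD k j i) h1
            (mul_nonneg (hA' k j i) (wordProd_nonneg hA' w i j)) hD0
        _ = D * r * r ^ w.length := by ring
    have : 0 ≤ (∑ p ∈ Finset.range N, (R / r) ^ p) * r ^ w.length := by positivity
    linarith

lemma exists_subeigenvector (hm : 0 < m) (hA : ∀ k i j, 0 < A k i j) {r : ℝ}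
    (hr : genSpecRad A < r) :
    ∃ x : Fin n → ℝ, (∀ i, 0 < x i) ∧ ∀ k i j, A k i j * x j ≤ r * x i := by
  have hA' : ∀ k i j, 0 ≤ A k i j := fun k i j => (hA k i j).le
  have hr0 : 0 < r := (genSpecRad_nonneg hA').trans_lt hr
  obtain ⟨C, hC⟩ := exists_wordProd_le hm hA hr
  let g : Fin n → List (Fin m) × Fin n → ℝ := fun i q => wordProd A q.1 i q.2 / r ^ q.1.length
  have hg : ∀ i, BddAbove (Set.range (g i)) := by
    intro i
    refine ⟨C, ?_⟩
    rintro _ ⟨q, rfl⟩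
    exact (div_le_iff₀ (by positivity)).2 (hC q.1 i q.2)
  refine ⟨fun i => ⨆ q, g i q, fun i => ?_, fun k i j => ?_⟩
  · refine one_pos.trans_le ((le_ciSup (hg i) ([], i)).trans' ?_)
    simp [g, wordProd]
  · rw [Real.mul_iSup_of_nonneg (hA' k i j)]
    refine ciSup_le fun q => ?_
    refine le_trans ?_ (mul_le_mul_of_nonneg_left (le_ciSup (hg i) (k :: q.1, q.2)) hr0.le)
    have h := mul_wordProd_le hA' k q.1 i j q.2
    simp only [g, List.length_cons]
    rw [← mul_div_assoc, ← mul_div_assoc, pow_succ', mul_div_mul_left _ _ hr0.ne']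
    gcongr

end WordProd

lemma isCompact_subeigenvectors {n m : ℕ} [NeZero n] (hm : 0 < m) {A : Fin m → Fin n → Fin n → ℝ}
    (hA : ∀ k i j, 0 < A k i j) {r : ℝ} (hr : 0 ≤ r) :
    IsCompact {x : Fin n → ℝ | (∀ i, 0 < x i) ∧ (∀ k, errF (A k) x ≤ r) ∧ x 0 = 1} := by
  have heq : {x : Fin n → ℝ | (∀ i, 0 < x i) ∧ (∀ k, errF (A k) x ≤ r) ∧ x 0 = 1} =
      {x : Fin n → ℝ | (∀ k i j, A k i j * x j ≤ r * x i) ∧ x 0 = 1} := by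
    ext x
    constructor
    · rintro ⟨h0, h, h1⟩
      exact ⟨fun k => (errF_le_iff h0).1 (h k), h1⟩
    · rintro ⟨h, h1⟩
      have h0 : ∀ i, 0 < x i := fun i => by
        have h2 := h ⟨0, hm⟩ i 0
        rw [h1, mul_one] at h2
        exact pos_of_mul_pos_right ((hA _ _ _).trans_le h2) hr
      exact ⟨h0, fun k => (errF_le_iff h0).2 (h k), h1⟩
  refine Metric.isCompact_of_isClosed_isBounded ?_ ?_
  · rw [heq]
    simp only [Set.ofPred_and, Set.ofPred_forall]
    refine IsClosed.inter (isClosed_iInter fun k => isClosed_iInter fun i => isClosed_iInter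
      fun j => isClosed_le (by fun_prop) (by fun_prop)) (isClosed_eq (by fun_prop) (by fun_prop))
  · refine (Metric.isBounded_Icc (0 : Fin n → ℝ) fun j => r / A ⟨0, hm⟩ 0 j).subset ?_
    rintro x ⟨h0, h, h1⟩
    refine ⟨fun i => (h0 i).le, fun j => ?_⟩
    have h2 := (errF_le_iff h0).1 (h ⟨0, hm⟩) 0 j
    rw [h1, mul_one] at h2
    exact (le_div_iff₀' (hA _ _ _)).2 h2

lemma exists_normalized_subeigenvector {n m : ℕ} [NeZero n] (hm : 0 < m)
    {A : Fin m → Fin n → Fin n → ℝ} (hA : ∀ k i j, 0 < A k i j) {r : ℝ} (hr : genSpecRad A < r) :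
    ∃ x : Fin n → ℝ, (∀ i, 0 < x i) ∧ (∀ k, errF (A k) x ≤ r) ∧ x 0 = 1 := by
  obtain ⟨x, hx, h⟩ := exists_subeigenvector hm hA hr
  refine ⟨fun i => (x 0)⁻¹ * x i, fun i => mul_pos (inv_pos.2 (hx 0)) (hx i), fun k => ?_,
    inv_mul_cancel₀ (hx 0).ne'⟩
  rw [errF_smul _ _ (inv_ne_zero (hx 0).ne')]
  exact (errF_le_iff hx).2 (h k)

lemma exists_extremal_subeigenvector {n m : ℕ} [NeZero n] (hm : 0 < m)
    {A : Fin m → Fin n → Fin n → ℝ} (hA : ∀ k i j, 0 < A k i j) :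
    ∃ x : Fin n → ℝ, (∀ i, 0 < x i) ∧ (∀ k, errF (A k) x ≤ genSpecRad A) ∧ x 0 = 1 := by
  have hm' : Nonempty (Fin m) := ⟨⟨0, hm⟩⟩
  have hρ : 0 ≤ genSpecRad A := genSpecRad_nonneg fun k i j => (hA k i j).le
  obtain ⟨x, ⟨hx0, -, hx1⟩, hmin⟩ :=
    (isCompact_subeigenvectors hm hA (r := genSpecRad A + 1) (by positivity)).exists_isMinOn
      (exists_normalized_subeigenvector hm hA (lt_add_one _))
      ((continuousOn_ciSup_of_finite fun k => continuousOn_errF (A k)).mono fun x hx => hx.1)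
  refine ⟨x, hx0, fun k => le_of_forall_gt_imp_ge_of_dense fun r hr => ?_, hx1⟩
  obtain ⟨y, hy0, hy, hy1⟩ :=
    exists_normalized_subeigenvector hm hA (lt_min hr (lt_add_one (genSpecRad A)))
  exact ((le_ciSup_of_finite (fun k => errF (A k) x) k).trans
    (hmin ⟨hy0, fun k => (hy k).trans (min_le_right _ _), hy1⟩)).trans
    (ciSup_le fun k => (hy k).trans (min_le_left _ _))

/-- for a finite family of SR-matrices there exists `x ∈ D_Ψ` that is
Pareto optimal with respect to all positive vectors; such an `x` is simultaneously
min-max optimal since `max_k e_{A_k}(x) = μ̂(Ψ)`. -/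
theorem stmt19 {n m : ℕ} (hm : 0 < m) (A : Fin m → Fin (n + 1) → Fin (n + 1) → ℝ)
    (hSR : ∀ k, IsSR (A k)) :
    ∃ x ∈ {z ∈ ⋂ k, Cset (A k) (genSpecRad A) | z 0 = 1},
      (⨆ k, errF (A k) x) = genSpecRad A ∧
      ∀ y : Fin (n + 1) → ℝ, (∀ i, 0 < y i) →
        (∀ k, errF (A k) y ≤ errF (A k) x) → ∀ k, errF (A k) y = errF (A k) x := by
  have hm' : Nonempty (Fin m) := ⟨⟨0, hm⟩⟩
  have hA : ∀ k i j, 0 < A k i j := fun k => (hSR k).1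
  have hA' : ∀ k i j, 0 ≤ A k i j := fun k i j => (hA k i j).le
  obtain ⟨x, ⟨hx0, hx, hx1⟩, hmin⟩ :=
    (isCompact_subeigenvectors hm hA (genSpecRad_nonneg hA')).exists_isMinOn
      (exists_extremal_subeigenvector hm hA)
      ((continuousOn_finsetSum Finset.univ fun k _ => continuousOn_errF (A k)).mono
        fun x hx => hx.1)
  refine ⟨x, ⟨Set.mem_iInter.2 fun k => mem_Cset_iff.2 ⟨hx0, hx k⟩, hx1⟩, ?_, ?_⟩
  · have h : ∀ k i j, A k i j * x j ≤ (⨆ k, errF (A k) x) * x i := fun k =>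
      (errF_le_iff hx0).1 (le_ciSup_of_finite (fun k => errF (A k) x) k)
    refine le_antisymm (ciSup_le hx) (genSpecRad_le hA' hx0 ?_ h)
    have h1 := h ⟨0, hm⟩ 0 0
    rw [hx1, mul_one, mul_one] at h1
    exact (hA' _ _ _).trans h1
  · intro y hy hle k
    have hc := inv_pos.2 (hy 0)
    have hsum := hmin (a := fun i => (y 0)⁻¹ * y i) ⟨fun i => mul_pos hc (hy i), fun k => by
      rw [errF_smul _ _ hc.ne']
      exact (hle k).trans (hx k), inv_mul_cancel₀ (hy 0).ne'⟩
    simp only [Set.mem_ofPred_eq, errF_smul _ _ hc.ne'] at hsum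
    exact (Finset.sum_eq_sum_iff_of_le fun k _ => hle k).1
      (le_antisymm (Finset.sum_le_sum fun k _ => hle k) hsum) k (Finset.mem_univ k)

end MaxAlg
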